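/- If the hypergraph 𝒜 ⊆ 𝒫_f(I) has the strong intersection property, then the free presheaf V admits an interaction decomposition: there are subspaces S_β ⊆ V_β such that V_α = ⊕_{β⊆α, β∈𝒜} j_{αβ}(S_β) for every α∈𝒜. If 𝒜 has the weak intersection property, then the reduced presheaf V̄ admits an interaction decomposition. -/

import Mathlib

universe u v w

/-- The product set `E_α = Π_{i ∈ α} E_i`. -/
def EProd {I : Type u} (E : I → Type w) (α : Finset I) : Type (max u w) :=
  ∀ i : α, E i.1

/-- The projection `π^{βα} : E_α → E_β` for `β ⊆ α`. -/
def resE {I : Type u} (E : I → Type w) {α β : Finset I} (h : β ⊆ α) :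
    EProd E α → EProd E β :=
  fun f i => f ⟨i.1, h i.2⟩

/-- The injection `j_{αβ} : V_β → V_α` of the free presheaf (`V_α = K^{E_α}`), given by
precomposition with `π^{βα}`. -/
def jmap {I : Type u} (E : I → Type w) (K : Type v) [Field K] {α β : Finset I}
    (h : β ⊆ α) : (EProd E β → K) →ₗ[K] (EProd E α → K) where
  toFun g := g ∘ resE E h
  map_add' _ _ := rfl
  map_smul' _ _ := rfl

/-- The inclusion of constants `K → K^{E_α}`. -/
def constLin {I : Type u} (E : I → Type w) (K : Type v) [Field K] (α : Finset I) :
    K →ₗ[K] (EProd E α → K) where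
  toFun c := fun _ => c
  map_add' _ _ := rfl
  map_smul' _ _ := rfl

/-- The one-dimensional subspace `K_α ⊆ V_α` of constant functions. -/
def constSub {I : Type u} (E : I → Type w) (K : Type v) [Field K] (α : Finset I) :
    Submodule K (EProd E α → K) :=
  LinearMap.range (constLin E K α)

/-- The reduced space `V̄_α = V_α / K_α`. -/
abbrev Vbar {I : Type u} (E : I → Type w) (K : Type v) [Field K] (α : Finset I) :=
  (EProd E α → K) ⧸ constSub E K α

/-- The induced injective map `j̄_{αβ} : V̄_β → V̄_α` of the reduced presheaf. -/
def jbar {I : Type u} (E : I → Type w) (K : Type v) [Field K] {α β : Finset I}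
    (h : β ⊆ α) : Vbar E K β →ₗ[K] Vbar E K α :=
  Submodule.mapQ (constSub E K β) (constSub E K α) (jmap E K h)
    (by rintro x ⟨c, rfl⟩; exact ⟨c, rfl⟩)

/-- If `W` is a presheaf with structure maps `j` and retractions `p` which commute with them over
intersections, and if for all members `β`, `β'` of `A` either `β ∩ β' ∈ A` or `W (β ∩ β')` is
trivial, then `W` has an interaction decomposition over `A`. -/
theorem exists_interactionDecomposition_of_retractions {I : Type*} [DecidableEq I]
    {A : Set (Finset I)} {K : Type*} [Field K] {W : Finset I → Type*}
    [∀ α, AddCommGroup (W α)] [∀ α, Module K (W α)]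
    (j : ∀ {α β : Finset I}, β ⊆ α → W β →ₗ[K] W α)
    (p : ∀ {α β : Finset I}, β ⊆ α → W α →ₗ[K] W β)
    (j_id : ∀ α (x : W α), j (Finset.Subset.refl α) x = x)
    (j_comp : ∀ {α β γ : Finset I} (h : β ⊆ α) (h' : γ ⊆ β) (x : W γ),
      j h (j h' x) = j (h'.trans h) x)
    (p_j : ∀ {α β : Finset I} (h : β ⊆ α) (x : W β), p h (j h x) = x)
    (p_j_inter : ∀ {α β β' : Finset I} (h : β ⊆ α) (h' : β' ⊆ α) (x : W β'),
      p h (j h' x) =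
        j (Finset.inter_subset_left : β ∩ β' ⊆ β) (p Finset.inter_subset_right x))
    (hA : ∀ β ∈ A, ∀ β' ∈ A, β ∩ β' ∈ A ∨ Subsingleton (W (β ∩ β'))) :
    ∃ S : ∀ γ : Finset I, Submodule K (W γ),
      ∀ α ∈ A,
        letI : DecidableEq {β : Finset I // β ∈ A ∧ β ⊆ α} := Classical.decEq _
        DirectSum.IsInternal
          (fun β : {β : Finset I // β ∈ A ∧ β ⊆ α} => Submodule.map (j β.2.2) (S β.1)) := by
  let N : ∀ γ : Finset I, Submodule K (W γ) := fun γ =>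
    ⨆ β : {β : Finset I // β ∈ A ∧ β ⊂ γ}, LinearMap.range (j β.2.2.subset)
  choose S hS using fun γ => Submodule.exists_isCompl (N γ)
  refine ⟨S, fun α hα => ?_⟩
  let _ : DecidableEq {β : Finset I // β ∈ A ∧ β ⊆ α} := Classical.decEq _
  refine DirectSum.isInternal_submodule_of_iSupIndep_of_iSup_eq_top ?_ ?_
  · rw [iSupIndep_iff_finsetSum_eq_zero_imp_eq_zero]
    intro s v hv hsum
    by_contra! hne
    obtain ⟨b, ⟨hbs, hb0⟩, hmax⟩ :=
      (s.finite_toSet.subset (t := {b | b ∈ s ∧ v b ≠ 0}) fun _ h => h.1).exists_maximal hne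
    obtain ⟨x, hx, hxb⟩ := hv b hbs
    have hterm : ∀ c ∈ s, c ≠ b → p b.2.2 (v c) ∈ N b.1 := by
      intro c hcs hcb
      by_cases hc0 : v c = 0
      · rw [hc0, map_zero]
        exact zero_mem _
      obtain ⟨y, -, hy⟩ := hv c hcs
      rw [← hy, p_j_inter]
      rcases hA b.1 b.2.1 c.1 c.2.1 with hbc | hbc
      · have hlt : b.1 ∩ c.1 ⊂ b.1 :=
          Finset.inter_subset_left.ssubset_of_ne fun h =>
            have hle : b ≤ c := Finset.inter_eq_left.mp h
            hcb ((hmax ⟨hcs, hc0⟩ hle).antisymm hle)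
        exact Submodule.mem_iSup_of_mem ⟨b.1 ∩ c.1, hbc, hlt⟩ ⟨_, rfl⟩
      · rw [Subsingleton.elim (p Finset.inter_subset_right y) 0, map_zero]
        exact zero_mem _
    have hxN : x ∈ N b.1 := by
      classical
      have h := congrArg (p b.2.2) hsum
      rw [map_zero, map_sum, ← Finset.add_sum_erase s _ hbs, ← hxb, p_j] at h
      rw [eq_neg_of_add_eq_zero_left h]
      exact neg_mem (sum_mem fun c hc =>
        hterm c (Finset.mem_of_mem_erase hc) (Finset.ne_of_mem_erase hc))
    have hx0 : x = 0 := Submodule.disjoint_def.mp (hS b.1).disjoint x hxN hx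
    exact hb0 (by rw [← hxb, hx0, map_zero])
  · induction α using Finset.strongInduction with
    | H α ih =>
      rw [eq_top_iff, ← (hS α).sup_eq_top]
      refine sup_le (iSup_le ?_) ?_
      · rintro ⟨β, hβA, hβ⟩
        rw [LinearMap.range_eq_map, ← ih β hβ hβA, Submodule.map_iSup]
        refine iSup_le ?_
        rintro ⟨γ, hγA, hγ⟩
        refine le_trans ?_ (le_iSup _ ⟨γ, hγA, hγ.trans hβ.subset⟩)
        rintro _ ⟨_, ⟨x, hx, rfl⟩, rfl⟩
        exact ⟨x, hx, (j_comp _ _ _).symm⟩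
      · exact fun x hx => Submodule.mem_iSup_of_mem ⟨α, hα, Finset.Subset.refl α⟩
          ⟨x, hx, j_id α x⟩

section BasePoint

variable {I : Type u} {E : I → Type w}

/-- The extension `E_β → E_α` of a point by the coordinates of a base point `e`. -/
def extE [DecidableEq I] (e : ∀ i, E i) {α β : Finset I} (x : EProd E β) : EProd E α :=
  fun i => if h : i.1 ∈ β then x ⟨i.1, h⟩ else e i.1

/-- The restriction `V_α → V_β` along the base point extension `E_β → E_α`. -/
def pmap [DecidableEq I] (e : ∀ i, E i) (K : Type v) [Field K] (α β : Finset I) :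
    (EProd E α → K) →ₗ[K] (EProd E β → K) :=
  LinearMap.funLeft K K (extE e)

/-- The map `V̄_α → V̄_β` induced by `pmap`. -/
def pbar [DecidableEq I] (e : ∀ i, E i) (K : Type v) [Field K] (α β : Finset I) :
    Vbar E K α →ₗ[K] Vbar E K β :=
  Submodule.mapQ (constSub E K α) (constSub E K β) (pmap e K α β)
    (by rintro x ⟨c, rfl⟩; exact ⟨c, rfl⟩)

theorem resE_extE [DecidableEq I] (e : ∀ i, E i) {α β : Finset I} (h : β ⊆ α) (x : EProd E β) :
    resE E h (extE e x) = x := by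
  funext i
  simp [resE, extE]

theorem resE_extE_inter [DecidableEq I] (e : ∀ i, E i) {α β β' : Finset I} (h' : β' ⊆ α)
    (x : EProd E β) :
    resE E h' (extE e x) =
      extE e (resE E (Finset.inter_subset_left : β ∩ β' ⊆ β) x) := by
  funext i
  simp [resE, extE]

theorem pmap_jmap [DecidableEq I] (e : ∀ i, E i) (K : Type v) [Field K] {α β : Finset I}
    (h : β ⊆ α) (f : EProd E β → K) : pmap e K α β (jmap E K h f) = f :=
  funext fun x => congrArg f (resE_extE e h x)

theorem pmap_jmap_inter [DecidableEq I] (e : ∀ i, E i) (K : Type v) [Field K]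
    {α β β' : Finset I} (h' : β' ⊆ α) (f : EProd E β' → K) :
    pmap e K α β (jmap E K h' f) =
      jmap E K (Finset.inter_subset_left : β ∩ β' ⊆ β) (pmap e K β' (β ∩ β') f) :=
  funext fun x => congrArg f (resE_extE_inter e h' x)

theorem subsingleton_vbar_empty (E : I → Type w) (K : Type v) [Field K] :
    Subsingleton (Vbar E K (∅ : Finset I)) := by
  have : Subsingleton (EProd E (∅ : Finset I)) :=
    ⟨fun _ _ => funext fun i => absurd i.2 (Finset.notMem_empty _)⟩
  rw [Submodule.Quotient.subsingleton_iff, eq_top_iff]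
  rintro f -
  exact ⟨f fun i => absurd i.2 (Finset.notMem_empty _),
    funext fun x => congrArg f (Subsingleton.elim _ _)⟩

end BasePoint

/-- If the hypergraph `𝒜 ⊆ 𝒫_f(I)` has the strong intersection property,
then the free presheaf `V` admits an interaction decomposition: there are subspaces
`S_β ⊆ V_β` with `V_α = ⊕_{β ∈ 𝒜, β ⊆ α} j_{αβ}(S_β)` for every `α ∈ 𝒜`.  If `𝒜` has the
weak intersection property, then the reduced presheaf `V̄` admits an interaction
decomposition. -/
theorem free_and_reduced_interactionDecomposition {I : Type u} [DecidableEq I]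
    (A : Set (Finset I)) (E : I → Type w) [∀ i, Nonempty (E i)] (K : Type v) [Field K] :
    ((∀ α ∈ A, ∀ α' ∈ A, α ∩ α' ∈ A) →
      ∃ S : ∀ γ : Finset I, Submodule K (EProd E γ → K),
        ∀ α ∈ A,
          letI : DecidableEq {β : Finset I // β ∈ A ∧ β ⊆ α} := Classical.decEq _
          DirectSum.IsInternal
            (fun β : {β : Finset I // β ∈ A ∧ β ⊆ α} =>
              Submodule.map (jmap E K β.2.2) (S β.1))) ∧
    ((∀ α ∈ A, ∀ α' ∈ A, (α ∩ α').Nonempty → α ∩ α' ∈ A) →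
      ∃ Sb : ∀ γ : Finset I, Submodule K (Vbar E K γ),
        ∀ α ∈ A,
          letI : DecidableEq {β : Finset I // β ∈ A ∧ β ⊆ α} := Classical.decEq _
          DirectSum.IsInternal
            (fun β : {β : Finset I // β ∈ A ∧ β ⊆ α} =>
              Submodule.map (jbar E K β.2.2) (Sb β.1))) := by
  obtain ⟨e⟩ : Nonempty (∀ i, E i) := inferInstance
  refine ⟨fun hA => ?_, fun hA => ?_⟩
  · exact exists_interactionDecomposition_of_retractions (W := fun α => EProd E α → K)
      (fun h => jmap E K h) (fun {α β} _ => pmap e K α β)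
      (fun _ _ => rfl) (fun _ _ _ => rfl) (fun h f => pmap_jmap e K h f)
      (fun _ h' f => pmap_jmap_inter e K h' f) (fun β hβ β' hβ' => Or.inl (hA β hβ β' hβ'))
  · refine exists_interactionDecomposition_of_retractions (W := fun α => Vbar E K α)
      (fun h => jbar E K h) (fun {α β} _ => pbar e K α β) ?_ ?_ ?_ ?_ ?_
    · rintro α ⟨f⟩
      rfl
    · rintro α β γ h h' ⟨f⟩
      rfl
    · rintro α β h ⟨f⟩
      exact congrArg (Submodule.Quotient.mk (p := constSub E K β)) (pmap_jmap e K h f)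
    · rintro α β β' h h' ⟨f⟩
      exact congrArg (Submodule.Quotient.mk (p := constSub E K β)) (pmap_jmap_inter e K h' f)
    · intro β hβ β' hβ'
      rcases (β ∩ β').eq_empty_or_nonempty with h | h
      · exact Or.inr (h ▸ subsingleton_vbar_empty E K)
      · exact Or.inl (hA β hβ β' hβ' h)
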